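/- Assume (A1), the CFL condition τ ≤ 1/(4Σ_{α≠0}ω(α,h)), and that the Fourier symbol satisfies m(ξ) ≤ −K|ξ|^{2s} on Q_h for some K > 0, s ∈ (0,1]. Let z solve the fully discrete heat-type equation ∂_τ z = L_h z with initial data φ ∈ ℓ¹(hℤ^N). Then there is a constant C such that ‖z(·,t_j)‖_{ℓ^∞(hℤ^N)} ≤ C t_j^{−N/(2s)} for all j ≥ 1. -/

import Mathlib

open Real

/-- The discrete diffusion operator `L_h φ(x_α) = Σ_{β≠0} (φ(x_α + x_β) - φ(x_α)) ω(β)`. -/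
noncomputable def discreteLh {N : ℕ} (ω : (Fin N → ℤ) → ℝ) (φ : (Fin N → ℤ) → ℝ)
    (α : Fin N → ℤ) : ℝ :=
  ∑' β : Fin N → ℤ, (φ (α + β) - φ α) * ω β

open MeasureTheory in
theorem aux_swap {X ι : Type*} [Countable ι] [MeasurableSpace X] (μ : Measure X)
    (a : ι → ℝ) (ha : Summable (fun i => |a i|)) (g : X → ℂ) (hg : Integrable g μ)
    (u : ι → X → ℂ) (hu : ∀ i, AEStronglyMeasurable (u i) μ) (M : ℝ)
    (hM : ∀ i x, ‖u i x‖ ≤ M) :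
    HasSum (fun i => (a i : ℂ) * ∫ x, g x * u i x ∂μ)
      (∫ x, g x * (∑' i, (a i : ℂ) * u i x) ∂μ) := by
  have hint : ∀ i, Integrable (fun x => g x * u i x) μ := fun i =>
    hg.mul_bdd (c := M) (hu i) (Filter.Eventually.of_forall (hM i))
  have key := hasSum_integral_of_summable_integral_norm (μ := μ)
    (F := fun i x => (a i : ℂ) * (g x * u i x)) (fun i => (hint i).const_mul _) ?_
  · convert! key using 2
    · rw [integral_const_mul]
    · ext x
      rw [← tsum_mul_left]
      congr 1
      ext i
      ring
  · refine Summable.of_nonneg_of_le (fun i => integral_nonneg fun x => norm_nonneg _)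
      (fun i => ?_) (ha.mul_right (∫ x, ‖g x‖ * M ∂μ))
    rw [← integral_const_mul]
    refine integral_mono ((hint i).const_mul _).norm ((hg.norm.mul_const M).const_mul _) ?_
    intro x
    simp only [norm_mul, Complex.norm_real, Real.norm_eq_abs]
    exact mul_le_mul_of_nonneg_left (mul_le_mul_of_nonneg_left (hM i x) (norm_nonneg _))
      (abs_nonneg _)

/-- phase -/
noncomputable def phase {N : ℕ} (h : ℝ) (β : Fin N → ℤ) (ξ : Fin N → ℝ) : ℝ :=
  ∑ i, ξ i * (h * β i)

/-- plane wave -/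
noncomputable def wave {N : ℕ} (h : ℝ) (β : Fin N → ℤ) (ξ : Fin N → ℝ) : ℂ :=
  Complex.exp ((phase h β ξ : ℝ) * Complex.I)

theorem phase_add {N : ℕ} (h : ℝ) (α β : Fin N → ℤ) (ξ : Fin N → ℝ) :
    phase h (α + β) ξ = phase h α ξ + phase h β ξ := by
  simp only [phase, ← Finset.sum_add_distrib, Pi.add_apply, Int.cast_add]
  exact Finset.sum_congr rfl fun i _ => by ring

theorem phase_neg {N : ℕ} (h : ℝ) (β : Fin N → ℤ) (ξ : Fin N → ℝ) :
    phase h (-β) ξ = - phase h β ξ := by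
  simp [phase]

theorem wave_add {N : ℕ} (h : ℝ) (α β : Fin N → ℤ) (ξ : Fin N → ℝ) :
    wave h (α + β) ξ = wave h α ξ * wave h β ξ := by
  simp only [wave, phase_add, ← Complex.exp_add]
  push_cast
  ring_nf

theorem norm_wave {N : ℕ} (h : ℝ) (β : Fin N → ℤ) (ξ : Fin N → ℝ) : ‖wave h β ξ‖ = 1 := by
  simp [wave, Complex.norm_exp_ofReal_mul_I]

theorem continuous_phase {N : ℕ} (h : ℝ) (β : Fin N → ℤ) : Continuous (phase h β) := by
  unfold phase; fun_prop

theorem continuous_wave {N : ℕ} (h : ℝ) (β : Fin N → ℤ) : Continuous (wave h β) := by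
  have := continuous_phase h β
  unfold wave; fun_prop

theorem wave_add_neg {N : ℕ} (h : ℝ) (β : Fin N → ℤ) (ξ : Fin N → ℝ) :
    wave h β ξ + wave h (-β) ξ = 2 * (Real.cos (phase h β ξ) : ℂ) := by
  simp only [wave, phase_neg]
  push_cast
  rw [Complex.two_cos]

open MeasureTheory in
/-- box measure -/
noncomputable def boxM (N : ℕ) (h : ℝ) : Measure (Fin N → ℝ) :=
  Measure.pi (fun _ => volume.restrict (Set.Ioc (-(π / h)) (π / h)))

open MeasureTheory in
theorem boxM_eq (N : ℕ) (h : ℝ) : boxM N h =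
    volume.restrict (Set.pi Set.univ fun _ => Set.Ioc (-(π / h)) (π / h)) := by
  rw [boxM, volume_pi, Measure.restrict_pi_pi]

open MeasureTheory in
instance boxM_fin (N : ℕ) (h : ℝ) : IsFiniteMeasure (boxM N h) := by
  unfold boxM; infer_instance

open MeasureTheory in
theorem integral_wave {N : ℕ} (h : ℝ) (hh : 0 < h) (β : Fin N → ℤ) :
    ∫ ξ, wave h β ξ ∂(boxM N h) = if β = 0 then (((2 * (π / h)) ^ N : ℝ) : ℂ) else 0 := by
  have h1 : ∀ n : ℤ, ∫ x in Set.Ioc (-(π / h)) (π / h), Complex.exp ((x * (h * n) : ℝ) * Complex.I)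
      = if n = 0 then ((2 * (π / h) : ℝ) : ℂ) else 0 := by
    intro n
    have hpi : 0 < π / h := div_pos Real.pi_pos hh
    rw [← intervalIntegral.integral_of_le (by linarith)]
    split_ifs with hn
    · subst hn
      simp
      ring
    · have hc : ((h * n : ℝ) : ℂ) * Complex.I ≠ 0 := by
        simp [hh.ne', hn]
      have := integral_exp_mul_complex (a := -(π / h)) (b := π / h) hc
      have e : Complex.exp (((h * n : ℝ) : ℂ) * Complex.I * ((π / h : ℝ) : ℂ))
        = Complex.exp (((h * n : ℝ) : ℂ) * Complex.I * ((-(π / h) : ℝ) : ℂ)) := by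
        rw [Complex.exp_eq_exp_iff_exists_int]
        refine ⟨n, ?_⟩
        have : (h : ℂ) ≠ 0 := by exact_mod_cast hh.ne'
        push_cast
        field_simp
        ring
      rw [e, sub_self, zero_div] at this
      rw [← this]
      refine intervalIntegral.integral_congr fun x _ => ?_
      congr 1
      push_cast
      ring
  have h2 : ∀ ξ : Fin N → ℝ, wave h β ξ =
      ∏ i, (fun (i : Fin N) (x : ℝ) => Complex.exp ((x * (h * β i) : ℝ) * Complex.I)) i (ξ i) := by
    intro ξ
    rw [← Complex.exp_sum, wave, phase, ← Finset.sum_mul]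
    push_cast
    rfl
  simp_rw [h2]
  rw [boxM, integral_fintype_prod_eq_prod
    (f := fun (i : Fin N) (x : ℝ) => Complex.exp ((x * (h * β i) : ℝ) * Complex.I))]
  simp_rw [h1]
  split_ifs with hb
  · subst hb; simp
  · obtain ⟨i, hi⟩ := Function.ne_iff.mp hb
    exact Finset.prod_eq_zero (Finset.mem_univ i) (if_neg (by simpa using hi))

open MeasureTheory in
theorem integrable_stretched (N : ℕ) (hN : 0 < N) (K p : ℝ) (hK : 0 < K) (hp : 0 < p) :
    Integrable (fun x : Fin N → ℝ => Real.exp (-K * ‖x‖ ^ p)) := by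
  have : Nonempty (Fin N) := ⟨⟨0, hN⟩⟩
  have := (integrable_fun_norm_addHaar (E := Fin N → ℝ) volume
    (f := fun y => Real.exp (-K * y ^ p))).2 ?_
  · exact this
  have hq : (-1 : ℝ) < ((N - 1 : ℕ) : ℝ) := by
    have : (0:ℝ) ≤ ((N - 1 : ℕ) : ℝ) := Nat.cast_nonneg _
    linarith
  have e := integral_rpow_mul_exp_neg_mul_rpow hp hq hK
  simp only [Module.finrank_fin_fun, smul_eq_mul]
  simp only [Real.rpow_natCast] at e
  by_contra hcon
  rw [integral_undef hcon] at e
  have h3 : 0 < K ^ (-((((N - 1 : ℕ) : ℝ)) + 1) / p) * (1 / p)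
      * Real.Gamma ((((N - 1 : ℕ) : ℝ) + 1) / p) := by
    have : 0 < (((N - 1 : ℕ) : ℝ) + 1) / p := div_pos (by linarith) hp
    have := Real.Gamma_pos_of_pos this
    positivity
  linarith

open MeasureTheory in
theorem box_bound (N : ℕ) (hN : 0 < N) (h K p t : ℝ) (hK : 0 < K) (hp : 0 < p) (ht : 0 < t) :
    Integrable (fun x : Fin N → ℝ => Real.exp (-K * (t * ‖x‖ ^ p))) (boxM N h) ∧
    ∫ x : Fin N → ℝ, Real.exp (-K * (t * ‖x‖ ^ p)) ∂(boxM N h)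
      ≤ t ^ (-(N : ℝ) / p) * ∫ x : Fin N → ℝ, Real.exp (-K * ‖x‖ ^ p) := by
  set R := t ^ (1 / p) with hR
  have hRpos : 0 < R := Real.rpow_pos_of_pos ht _
  have e : (fun x : Fin N → ℝ => Real.exp (-K * (t * ‖x‖ ^ p))) =
      fun x => (fun y : Fin N → ℝ => Real.exp (-K * ‖y‖ ^ p)) (R • x) := by
    ext x
    simp only
    rw [norm_smul, Real.mul_rpow (norm_nonneg _) (norm_nonneg _), Real.norm_of_nonneg hRpos.le,
      hR, ← Real.rpow_mul ht.le, one_div_mul_cancel hp.ne', Real.rpow_one]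
  have hi : Integrable (fun x : Fin N → ℝ => Real.exp (-K * (t * ‖x‖ ^ p))) := by
    rw [e]
    exact (integrable_stretched N hN K p hK hp).comp_smul hRpos.ne'
  rw [boxM_eq]
  refine ⟨hi.restrict, ?_⟩
  refine (setIntegral_le_integral hi 
    (Filter.Eventually.of_forall fun x => (Real.exp_pos _).le)).trans ?_
  rw [e, Measure.integral_comp_smul volume (fun y : Fin N → ℝ => Real.exp (-K * ‖y‖ ^ p)) R, Module.finrank_fin_fun, smul_eq_mul,
    abs_of_pos (by positivity)]
  apply le_of_eq
  congr 1
  rw [hR, ← Real.rpow_natCast, ← Real.rpow_mul ht.le, ← Real.rpow_neg ht.le]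
  congr 1
  ring

/-- symbol -/
noncomputable def symb {N : ℕ} (h : ℝ) (ω : (Fin N → ℤ) → ℝ) (ξ : Fin N → ℝ) : ℝ :=
  -∑' β : Fin N → ℤ, ω β * (1 - Real.cos (phase h β ξ))

section symbol
variable {N : ℕ} (h : ℝ) (ω : (Fin N → ℤ) → ℝ)

theorem symb_term_bound (hnonneg : ∀ α, 0 ≤ ω α) (β : Fin N → ℤ) (ξ : Fin N → ℝ) :
    0 ≤ ω β * (1 - Real.cos (phase h β ξ)) ∧
    ω β * (1 - Real.cos (phase h β ξ)) ≤ 2 * ω β := by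
  have h1 := Real.cos_le_one (phase h β ξ)
  have h2 := Real.neg_one_le_cos (phase h β ξ)
  have := hnonneg β
  constructor <;> nlinarith

theorem symb_summable (hnonneg : ∀ α, 0 ≤ ω α) (hsum : Summable ω) (ξ : Fin N → ℝ) :
    Summable fun β => ω β * (1 - Real.cos (phase h β ξ)) :=
  Summable.of_nonneg_of_le (fun β => (symb_term_bound h ω hnonneg β ξ).1)
    (fun β => (symb_term_bound h ω hnonneg β ξ).2) (hsum.mul_left 2)

theorem symb_bounds (hnonneg : ∀ α, 0 ≤ ω α) (hsum : Summable ω) (ξ : Fin N → ℝ) :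
    -(2 * ∑' β, ω β) ≤ symb h ω ξ ∧ symb h ω ξ ≤ 0 := by
  unfold symb
  have h1 : 0 ≤ ∑' β, ω β * (1 - Real.cos (phase h β ξ)) :=
    tsum_nonneg fun β => (symb_term_bound h ω hnonneg β ξ).1
  have h2 : ∑' β, ω β * (1 - Real.cos (phase h β ξ)) ≤ ∑' β, 2 * ω β :=
    (symb_summable h ω hnonneg hsum ξ).tsum_le_tsum
      (fun β => (symb_term_bound h ω hnonneg β ξ).2) (hsum.mul_left 2)
  rw [tsum_mul_left] at h2
  constructor <;> linarith

theorem continuous_symb (hnonneg : ∀ α, 0 ≤ ω α) (hsum : Summable ω) :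
    Continuous (symb h ω) := by
  unfold symb
  refine (continuous_tsum (u := fun β => 2 * ω β) (fun β => ?_) (hsum.mul_left 2) ?_).neg
  · have := continuous_phase h β
    fun_prop
  · intro β ξ
    have := symb_term_bound h ω hnonneg β ξ
    rw [Real.norm_of_nonneg this.1]
    exact this.2

theorem symb_eq (hsym : ∀ α, ω (-α) = ω α) (hnonneg : ∀ α, 0 ≤ ω α) (hsum : Summable ω)
    (ξ : Fin N → ℝ) :
    ∑' β, (ω β : ℂ) * (wave h β ξ - 1) = (symb h ω ξ : ℂ) := by
  have hS : Summable fun β => (ω β : ℂ) * (wave h β ξ - 1) := by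
    refine Summable.of_norm_bounded (g := fun β => ω β * 2) (hsum.mul_right 2) fun β => ?_
    rw [norm_mul, Complex.norm_real, Real.norm_of_nonneg (hnonneg β)]
    refine mul_le_mul_of_nonneg_left ((norm_sub_le _ _).trans ?_) (hnonneg β)
    rw [norm_wave, norm_one]; norm_num
  have hS' : Summable fun β => (ω β : ℂ) * (wave h (-β) ξ - 1) := by
    have := (Equiv.neg (Fin N → ℤ)).summable_iff.2 hS
    refine this.congr fun β => ?_
    simp [hsym]
  have e1 : ∑' β, (ω β : ℂ) * (wave h (-β) ξ - 1) = ∑' β, (ω β : ℂ) * (wave h β ξ - 1) := by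
    rw [← (Equiv.neg (Fin N → ℤ)).tsum_eq (fun β => (ω β : ℂ) * (wave h β ξ - 1))]
    simp [hsym]
  have e2 := hS.tsum_add hS'
  rw [e1] at e2
  have e3 : ∀ β, (ω β : ℂ) * (wave h β ξ - 1) + (ω β : ℂ) * (wave h (-β) ξ - 1)
      = (-2 : ℂ) * ((ω β * (1 - Real.cos (phase h β ξ)) : ℝ) : ℂ) := by
    intro β
    have := wave_add_neg h β ξ
    push_cast at this ⊢
    linear_combination (ω β : ℂ) * this
  simp_rw [e3] at e2
  rw [tsum_mul_left, ← Complex.ofReal_tsum] at e2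
  unfold symb
  rw [Complex.ofReal_neg]
  linear_combination (-1/2 : ℂ) * e2
end symbol

/-- Fourier data -/
noncomputable def fdata {N : ℕ} (h : ℝ) (φ : (Fin N → ℤ) → ℝ) (ξ : Fin N → ℝ) : ℂ :=
  ∑' γ, (φ γ : ℂ) * wave h (-γ) ξ

theorem fdata_term {N : ℕ} (h : ℝ) (φ : (Fin N → ℤ) → ℝ) (γ : Fin N → ℤ) (ξ : Fin N → ℝ) :
    ‖(φ γ : ℂ) * wave h (-γ) ξ‖ = |φ γ| := by
  rw [norm_mul, norm_wave, mul_one, Complex.norm_real, Real.norm_eq_abs]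

theorem fdata_bound {N : ℕ} (h : ℝ) (φ : (Fin N → ℤ) → ℝ) (hφ : Summable (fun α => |φ α|))
    (ξ : Fin N → ℝ) : ‖fdata h φ ξ‖ ≤ ∑' γ, |φ γ| :=
  tsum_of_norm_bounded hφ.hasSum fun γ => (fdata_term h φ γ ξ).le

theorem continuous_fdata {N : ℕ} (h : ℝ) (φ : (Fin N → ℤ) → ℝ)
    (hφ : Summable (fun α => |φ α|)) : Continuous (fdata h φ) :=
  continuous_tsum (fun γ => continuous_const.mul (continuous_wave h (-γ))) hφ
    fun γ ξ => (fdata_term h φ γ ξ).le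

theorem stmt17 (N : ℕ) (hN : 0 < N) (h τ K s : ℝ) (hh : 0 < h) (hτ : 0 < τ)
    (hK : 0 < K) (hs : s ∈ Set.Ioc (0 : ℝ) 1)
    (ω : (Fin N → ℤ) → ℝ)
    (hsym : ∀ α, ω (-α) = ω α) (hnonneg : ∀ α, 0 ≤ ω α) (hω0 : ω 0 = 0)
    (hsum : Summable ω) (hpos : 0 < ∑' α, ω α)
    (hCFL : τ ≤ 1 / (4 * ∑' α, ω α))
    (hsymb : ∀ ξ : Fin N → ℝ, (∀ i, |ξ i| ≤ π / h) →
      -∑' β : Fin N → ℤ, ω β * (1 - Real.cos (∑ i, ξ i * (h * β i))) ≤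
        -K * (Real.sqrt (∑ i, ξ i ^ 2)) ^ (2 * s))
    (φ : (Fin N → ℤ) → ℝ) (hφ : Summable (fun α => |φ α|))
    (z : ℕ → (Fin N → ℤ) → ℝ) (hz0 : ∀ α, z 0 α = φ α)
    (hscheme : ∀ j α, z (j + 1) α = z j α + τ * discreteLh ω (z j) α) :
    ∃ C : ℝ, ∀ j : ℕ, 1 ≤ j → ∀ α : Fin N → ℤ,
      |z j α| ≤ C * ((j : ℝ) * τ) ^ (-(N : ℝ) / (2 * s)) := by
  have hs0 : 0 < s := hs.1
  set S := ∑' γ, |φ γ| with hS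
  have hS0 : 0 ≤ S := tsum_nonneg fun _ => abs_nonneg _
  set c : ℝ := (2 * (π / h)) ^ N with hc
  have hcpos : 0 < c := by positivity
  have hτW : τ * (4 * ∑' α, ω α) ≤ 1 := by
    rwa [le_div_iff₀ (by positivity)] at hCFL
  have hPb : ∀ ξ, 0 ≤ 1 + τ * symb h ω ξ ∧ 1 + τ * symb h ω ξ ≤ 1 := by
    intro ξ
    have := symb_bounds h ω hnonneg hsum ξ
    constructor <;> nlinarith
  have hPn : ∀ (j : ℕ) ξ, ‖(((1 + τ * symb h ω ξ) ^ j : ℝ) : ℂ)‖ = (1 + τ * symb h ω ξ) ^ j := by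
    intro j ξ
    rw [Complex.norm_real, Real.norm_of_nonneg (pow_nonneg (hPb ξ).1 _)]
  have hcont := continuous_symb h ω hnonneg hsum
  have hΦc := continuous_fdata h φ hφ
  -- the integrand
  let G : ℕ → (Fin N → ℤ) → (Fin N → ℝ) → ℂ := fun j α ξ =>
    (((1 + τ * symb h ω ξ) ^ j : ℝ) : ℂ) * fdata h φ ξ * wave h α ξ
  have hGn : ∀ j α ξ, ‖G j α ξ‖ ≤ (1 + τ * symb h ω ξ) ^ j * S := by
    intro j α ξ
    simp only [G, norm_mul, norm_wave, mul_one, hPn]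
    exact mul_le_mul_of_nonneg_left (fdata_bound h φ hφ ξ) (pow_nonneg (hPb ξ).1 _)
  have hGint : ∀ j α, MeasureTheory.Integrable (G j α) (boxM N h) := by
    intro j α
    have hcG : Continuous (G j α) := by
      have := continuous_wave h α
      simp only [G]
      fun_prop
    refine MeasureTheory.Integrable.of_bound hcG.aestronglyMeasurable S
      (Filter.Eventually.of_forall fun ξ => (hGn j α ξ).trans ?_)
    have := pow_le_one₀ (n := j) (hPb ξ).1 (hPb ξ).2
    nlinarith
  have hrep : ∀ j α, (c : ℂ) * (z j α : ℂ) = ∫ ξ, G j α ξ ∂(boxM N h) := by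
    intro j
    induction j with
    | zero =>
      intro α
      have hw : MeasureTheory.Integrable (wave h α) (boxM N h) :=
        MeasureTheory.Integrable.of_bound (continuous_wave h α).aestronglyMeasurable 1
          (Filter.Eventually.of_forall fun ξ => (norm_wave h α ξ).le)
      have key := (aux_swap (boxM N h) φ hφ (wave h α) hw (fun γ => wave h (-γ))
        (fun γ => (continuous_wave h (-γ)).aestronglyMeasurable) 1
        (fun γ ξ => (norm_wave h (-γ) ξ).le)).tsum_eq
      have e1 : ∫ ξ, G 0 α ξ ∂(boxM N h)
          = ∫ ξ, wave h α ξ * (∑' γ, (φ γ : ℂ) * wave h (-γ) ξ) ∂(boxM N h) := by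
        congr 1
        ext ξ
        simp only [G, pow_zero, Complex.ofReal_one, one_mul, fdata]
        ring
      rw [e1, ← key, tsum_eq_single α]
      · simp_rw [← wave_add]
        rw [integral_wave h hh, if_pos (by simp), hz0]
        ring
      · intro γ hγ
        simp_rw [← wave_add]
        rw [integral_wave h hh, if_neg, mul_zero]
        rw [← sub_eq_add_neg, sub_eq_zero]
        exact hγ.symm
    | succ j ih =>
      intro α
      have key := (aux_swap (boxM N h) ω (by simpa only [abs_of_nonneg (hnonneg _)] using hsum)
        (G j α) (hGint j α) (fun β ξ => wave h β ξ - 1)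
        (fun β => ((continuous_wave h β).sub continuous_const).aestronglyMeasurable) 2
        (fun β ξ => (norm_sub_le _ _).trans
          (by rw [norm_wave, norm_one]; norm_num))).tsum_eq
      have e1 : ∀ β, (ω β : ℂ) * ∫ ξ, G j α ξ * (wave h β ξ - 1) ∂(boxM N h)
          = (c : ℂ) * (((z j (α + β) - z j α) * ω β : ℝ) : ℂ) := by
        intro β
        have : ∀ ξ, G j α ξ * (wave h β ξ - 1) = G j (α + β) ξ - G j α ξ := by
          intro ξ
          simp only [G, wave_add]
          ring
        simp_rw [this]
        rw [MeasureTheory.integral_sub (hGint _ _) (hGint _ _), ← ih, ← ih]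
        push_cast
        ring
      simp_rw [e1, symb_eq h ω hsym hnonneg hsum] at key
      rw [tsum_mul_left, ← Complex.ofReal_tsum] at key
      change (c : ℂ) * ((discreteLh ω (z j) α : ℝ) : ℂ) = _ at key
      have e2 : ∀ ξ, G (j + 1) α ξ = G j α ξ + (τ : ℂ) * (G j α ξ * (symb h ω ξ : ℂ)) := by
        intro ξ
        simp only [G]
        push_cast
        ring
      simp_rw [e2]
      have hint2 : MeasureTheory.Integrable
          (fun ξ => (τ : ℂ) * (G j α ξ * (symb h ω ξ : ℂ))) (boxM N h) := by
        have := (hGint (j + 1) α).sub (hGint j α)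
        refine this.congr (Filter.Eventually.of_forall fun ξ => ?_)
        simp only [Pi.sub_apply, e2]
        ring
      rw [MeasureTheory.integral_add (hGint j α) hint2, MeasureTheory.integral_const_mul,
        ← key, ← ih, hscheme]
      push_cast
      ring
  refine ⟨c⁻¹ * (S * ∫ x : Fin N → ℝ, Real.exp (-K * ‖x‖ ^ (2 * s))), ?_⟩
  intro j hj α
  have ht : 0 < (j : ℝ) * τ := by
    have : (0 : ℝ) < j := by exact_mod_cast hj
    positivity
  obtain ⟨hI, hB⟩ := box_bound N hN h K (2 * s) ((j : ℝ) * τ) hK (by positivity) ht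
  have hae : ∀ᵐ ξ ∂(boxM N h),
      ‖G j α ξ‖ ≤ S * Real.exp (-K * ((j : ℝ) * τ * ‖ξ‖ ^ (2 * s))) := by
    rw [boxM_eq]
    refine (MeasureTheory.ae_restrict_mem
      (MeasurableSet.univ_pi fun _ => measurableSet_Ioc)).mono ?_
    intro ξ hξ
    have hq : ∀ i, |ξ i| ≤ π / h := fun i =>
      abs_le.2 ⟨(hξ i (Set.mem_univ i)).1.le, (hξ i (Set.mem_univ i)).2⟩
    have h1 : symb h ω ξ ≤ -K * (Real.sqrt (∑ i, ξ i ^ 2)) ^ (2 * s) := hsymb ξ hq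
    have h2 : ‖ξ‖ ≤ Real.sqrt (∑ i, ξ i ^ 2) := by
      rw [pi_norm_le_iff_of_nonneg (Real.sqrt_nonneg _)]
      intro i
      exact Real.abs_le_sqrt
        (Finset.single_le_sum (f := fun i => ξ i ^ 2) (fun i _ => sq_nonneg _) (Finset.mem_univ i))
    have h3 : ‖ξ‖ ^ (2 * s) ≤ (Real.sqrt (∑ i, ξ i ^ 2)) ^ (2 * s) :=
      Real.rpow_le_rpow (norm_nonneg _) h2 (by positivity)
    have h4 : symb h ω ξ ≤ -K * ‖ξ‖ ^ (2 * s) := by nlinarith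
    have h5 : 1 + τ * symb h ω ξ ≤ Real.exp (-K * (τ * ‖ξ‖ ^ (2 * s))) := by
      have := Real.add_one_le_exp (-K * (τ * ‖ξ‖ ^ (2 * s)))
      have := mul_le_mul_of_nonneg_left h4 hτ.le
      linarith
    have h6 := pow_le_pow_left₀ (hPb ξ).1 h5 j
    rw [← Real.exp_nat_mul] at h6
    refine (hGn j α ξ).trans ?_
    rw [mul_comm]
    refine mul_le_mul_of_nonneg_left (h6.trans (le_of_eq ?_)) hS0
    congr 1
    ring
  have hfin := MeasureTheory.norm_integral_le_of_norm_le (hI.const_mul S) hae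
  rw [← hrep, MeasureTheory.integral_const_mul, norm_mul, Complex.norm_real, Complex.norm_real,
    Real.norm_of_nonneg hcpos.le, Real.norm_eq_abs] at hfin
  have hfin2 := hfin.trans (mul_le_mul_of_nonneg_left hB hS0)
  calc |z j α| = c⁻¹ * (c * |z j α|) := by field_simp
    _ ≤ _ := mul_le_mul_of_nonneg_left hfin2 (inv_nonneg.2 hcpos.le)
    _ = _ := by ring
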